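/- Assume q mod n ∈ D₀ (so that d₀(x) and d₁(x) have coefficients in GF(q)). For j ∈ {0, 1}, the cyclic code over GF(q) of length n with generator polynomial g^{(j)}(x) = (x^n−1)(x−1)/((x^{n₁}−1)(x^{n₂}−1)·d_j(x)) has dimension n₁ + n₂ − 1 + (n₁−1)(n₂−1)/2, and its minimum distance d^{(j)} satisfies (d^{(j)})² ≥ min(n₁, n₂) (hence d^{(j)} ≥ ⌈√(min(n₁, n₂))⌉). Moreover, if −1 mod n ∈ D₁, then (d^{(j)})² − d^{(j)} + 1 ≥ min(n₁, n₂). -/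

import Mathlib

open Polynomial

section QuadraticResidueCodes

variable {K E : Type*} [Field K] [Fintype K] [DecidableEq K] [Field E]

/-- The Fourier transform of a word `v : K → E` with respect to an additive character `ψ`. -/
def wordTransform (ψ : AddChar K E) (v : K → E) (k : K) : E := ∑ z, v z * ψ (k * z)

theorem sum_char_mul_wordTransform {ψ : AddChar K E} (hψ : ψ.IsPrimitive) (v : K → E) (t : K) :
    ∑ k, ψ (-(k * t)) * wordTransform ψ v k = Fintype.card K * v t := by
  have key : ∀ z, ∑ k, ψ (-(k * t)) * (v z * ψ (k * z)) =
      if z = t then (Fintype.card K : E) * v t else 0 := by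
    intro z
    have h1 : ∀ k, ψ (-(k * t)) * (v z * ψ (k * z)) = v z * ψ (k * (z - t)) := by
      intro k
      rw [mul_left_comm, ← AddChar.map_add_eq_mul]
      congr 2; ring
    simp_rw [h1]
    rw [← Finset.mul_sum, AddChar.sum_mulShift _ hψ]
    by_cases h : z = t
    · simp [h, mul_comm]
    · simp [h, sub_ne_zero.mpr h]
  simp_rw [wordTransform, Finset.mul_sum]
  rw [Finset.sum_comm]
  simp_rw [key]
  simp

/-- If the transforms of `v` and of its dilation by `r` have disjoint supports away from `0`, then
every element of `K` is of the form `a + r * b` with `a` and `b` in the support of `v`. -/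
theorem exists_add_mul_eq_of_wordTransform {ψ : AddChar K E} (hψ : ψ.IsPrimitive) {v : K → E}
    {r : K} (h0 : ∑ z, v z ≠ 0)
    (hr : ∀ k ≠ 0, wordTransform ψ v k * wordTransform ψ v (r * k) = 0) (t : K) :
    ∃ a b, v a ≠ 0 ∧ v b ≠ 0 ∧ a + r * b = t := by
  by_contra! hno
  have h1 : ∑ k, ψ (-(k * t)) * (wordTransform ψ v k * wordTransform ψ v (r * k)) =
      (∑ z, v z) ^ 2 := by
    rw [Finset.sum_eq_single 0]
    · simp [wordTransform, sq]
    · intro k _ hk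
      rw [hr k hk, mul_zero]
    · simp
  have h2 : ∑ k, ψ (-(k * t)) * (wordTransform ψ v k * wordTransform ψ v (r * k)) =
      ∑ a, ∑ b, v a * v b * ∑ k, ψ (k * (a + r * b - t)) := by
    simp_rw [wordTransform, Finset.sum_mul_sum, Finset.mul_sum]
    rw [Finset.sum_comm]
    refine Finset.sum_congr rfl fun a _ => ?_
    rw [Finset.sum_comm]
    refine Finset.sum_congr rfl fun b _ => Finset.sum_congr rfl fun k _ => ?_
    have : k * (a + r * b - t) = -(k * t) + (k * a + r * k * b) := by ring
    rw [this, AddChar.map_add_eq_mul, AddChar.map_add_eq_mul]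
    ring
  apply pow_ne_zero 2 h0
  rw [← h1, h2]
  refine Finset.sum_eq_zero fun a _ => Finset.sum_eq_zero fun b _ => ?_
  rw [AddChar.sum_mulShift _ hψ]
  by_cases ha : v a = 0
  · simp [ha]
  by_cases hb : v b = 0
  · simp [hb]
  rw [if_neg (sub_ne_zero.mpr (hno a b ha hb))]
  simp

/-- The square-root bound for quadratic residue words with nonzero coordinate sum. -/
theorem card_le_of_quadraticChar_of_sum_ne_zero (hK : ringChar K ≠ 2) {ψ : AddChar K E}
    (hψ : ψ.IsPrimitive) {v : K → E} {ε : ℤ} (hε : ε = 1 ∨ ε = -1)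
    (hv : ∀ k, quadraticChar K k = ε → wordTransform ψ v k = 0) (h0 : ∑ z, v z ≠ 0)
    {S : Finset K} (hS : ∀ z, v z ≠ 0 → z ∈ S) :
    Fintype.card K ≤ S.card ^ 2 ∧
      (quadraticChar K (-1) = -1 → Fintype.card K ≤ S.card ^ 2 - S.card + 1) := by
  have main : ∀ r, quadraticChar K r = -1 → ∀ t, ∃ a ∈ S, ∃ b ∈ S, a + r * b = t := by
    intro r hr t
    obtain ⟨a, b, ha, hb, h⟩ := exists_add_mul_eq_of_wordTransform hψ (r := r) h0 (by
      intro k hk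
      by_cases h : quadraticChar K k = ε
      · rw [hv k h, zero_mul]
      · rw [hv (r * k), mul_zero]
        rw [map_mul, hr]
        rcases quadraticChar_dichotomy hk with h' | h' <;> rw [h'] at h ⊢ <;> lia) t
    exact ⟨a, hS a ha, b, hS b hb, h⟩
  constructor
  · obtain ⟨r, hr⟩ := quadraticChar_exists_neg_one hK
    have : (Finset.univ : Finset K) ⊆ (S ×ˢ S).image fun x => x.1 + r * x.2 := by
      intro t _
      obtain ⟨a, ha, b, hb, h⟩ := main r hr t
      exact Finset.mem_image.mpr ⟨(a, b), Finset.mem_product.mpr ⟨ha, hb⟩, h⟩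
    calc Fintype.card K ≤ _ := Finset.card_le_card this
      _ ≤ _ := Finset.card_image_le
      _ = _ := by rw [Finset.card_product, sq]
  · intro hneg
    have : (Finset.univ : Finset K) ⊆ insert 0 (S.offDiag.image fun x => x.1 - x.2) := by
      intro t _
      obtain ⟨a, ha, b, hb, h⟩ := main (-1) hneg t
      rw [Finset.mem_insert, or_iff_not_imp_left]
      intro ht
      refine Finset.mem_image.mpr ⟨(a, b), Finset.mem_offDiag.mpr ⟨ha, hb, ?_⟩, ?_⟩
      · intro hab
        apply ht
        rw [← h, show a = b from hab]; ring
      · rw [← h]; ring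
    calc Fintype.card K ≤ _ := Finset.card_le_card this
      _ ≤ _ := Finset.card_insert_le _ _
      _ ≤ S.offDiag.card + 1 := Nat.succ_le_succ Finset.card_image_le
      _ = _ := by rw [Finset.offDiag_card, sq]

variable (K E) in
/-- The quadratic character of `K` with values in `E`; it is trivial if `E` has characteristic
two. -/
def quadraticCharOn : MulChar K E := (quadraticChar K).ringHomComp (Int.castRingHom E)

theorem quadraticCharOn_apply (a : K) : quadraticCharOn K E a = (quadraticChar K a : E) := rfl

theorem quadraticChar_inv (a : K) : quadraticChar K a⁻¹ = quadraticChar K a := by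
  rw [← MulChar.inv_apply', (quadraticChar_isQuadratic K).inv]

theorem gaussSum_quadraticCharOn_ne_zero (hcard : (Fintype.card K : E) ≠ 0)
    {ψ : AddChar K E} (hψ : ψ.IsPrimitive) : gaussSum (quadraticCharOn K E) ψ ≠ 0 := by
  by_cases h : quadraticCharOn K E = 1
  · have hψ1 : ψ ≠ 1 := by
      rintro rfl
      exact hψ one_ne_zero (by ext; simp)
    rw [h, gaussSum_one_left hψ1]
    simp
  · exact gaussSum_ne_zero_of_nontrivial hcard h hψ

theorem sum_quadraticCharOn_mul_inv {j : K} (hj : j ≠ 0) (ψ : AddChar K E) :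
    ∑ z, quadraticCharOn K E z * ψ (j * z⁻¹) =
      quadraticCharOn K E j * gaussSum (quadraticCharOn K E) ψ := by
  rw [gaussSum, Finset.mul_sum]
  refine Finset.sum_nbij' (fun z => j * z⁻¹) (fun z => j * z⁻¹) (by simp) (by simp) ?_ ?_ ?_
  · intro z _
    by_cases hz : z = 0
    · simp [hz]
    · field_simp
  · intro z _
    by_cases hz : z = 0
    · simp [hz]
    · field_simp
  · intro z _
    rw [← mul_assoc, ← map_mul]
    have : quadraticCharOn K E (j * (j * z⁻¹)) = quadraticCharOn K E z := by
      have h : quadraticChar K (j * (j * z⁻¹)) = quadraticChar K z := by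
        rw [← mul_assoc, ← sq, map_mul, quadraticChar_sq_one' hj, one_mul, quadraticChar_inv]
      rw [quadraticCharOn_apply, h, quadraticCharOn_apply]
    rw [this]

/-- A Salié sum whose parameters have nonresidue product vanishes. -/
theorem sum_quadraticCharOn_mul_kloosterman {j k : K} (h : quadraticChar K (j * k) = -1)
    (ψ : AddChar K E) : ∑ z, quadraticCharOn K E z * ψ (k * z + j * z⁻¹) = 0 := by
  have hjk : j * k ≠ 0 := by
    intro h0
    rw [h0, quadraticChar_zero] at h
    norm_num at h
  have hj := left_ne_zero_of_mul hjk
  have hk := right_ne_zero_of_mul hjk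
  refine Finset.sum_involution (fun z _ => j * (k * z)⁻¹) ?_ ?_ (by simp) ?_
  · intro z _
    have hχ : quadraticCharOn K E (j * (k * z)⁻¹) = -quadraticCharOn K E z := by
      have h' : quadraticChar K (j * (k * z)⁻¹) = -quadraticChar K z := by
        rw [map_mul, quadraticChar_inv, ← map_mul, ← mul_assoc, map_mul, h, neg_one_mul]
      rw [quadraticCharOn_apply, h', quadraticCharOn_apply, Int.cast_neg]
    have hs : k * (j * (k * z)⁻¹) + j * (j * (k * z)⁻¹)⁻¹ = k * z + j * z⁻¹ := by
      by_cases hz : z = 0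
      · simp [hz]
      · field_simp
        ring
    rw [hχ, hs]
    ring
  · intro z _ hne heq
    have hz : z ≠ 0 := by
      rintro rfl
      simp [quadraticCharOn_apply] at hne
    have hsq : j * k = (k * z) ^ 2 := by
      field_simp at heq
      rw [heq]; ring
    have h1 := quadraticChar_sq_one' (F := K) (mul_ne_zero hk hz)
    rw [← hsq, h] at h1
    norm_num at h1
  · intro z _
    by_cases hz : z = 0
    · simp [hz]
    · field_simp

/-- The transform of the image of `v` under the Gleason–Prange map, which sends `v` to the word
with value `χ z * v (z₀ - z⁻¹)` at `z`. -/
theorem wordTransform_gleasonPrange {ψ : AddChar K E} (hψ : ψ.IsPrimitive) (v : K → E)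
    (z₀ k : K) :
    Fintype.card K * wordTransform ψ (fun z => quadraticCharOn K E z * v (z₀ - z⁻¹)) k =
      ∑ j, ψ (-(j * z₀)) * wordTransform ψ v j *
        ∑ z, quadraticCharOn K E z * ψ (k * z + j * z⁻¹) := by
  simp_rw [Finset.mul_sum]
  rw [Finset.sum_comm, wordTransform, Finset.mul_sum]
  refine Finset.sum_congr rfl fun z _ => ?_
  calc _ = (Fintype.card K * v (z₀ - z⁻¹)) * (quadraticCharOn K E z * ψ (k * z)) := by ring
    _ = _ := by
      rw [← sum_char_mul_wordTransform hψ, Finset.sum_mul]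
      refine Finset.sum_congr rfl fun j _ => ?_
      have : -(j * (z₀ - z⁻¹)) = -(j * z₀) + j * z⁻¹ := by ring
      rw [this, AddChar.map_add_eq_mul, AddChar.map_add_eq_mul]
      ring

/-- The square-root bound for quadratic residue codes. -/
theorem card_le_of_quadraticChar (hK : ringChar K ≠ 2) (hcard : (Fintype.card K : E) ≠ 0)
    {ψ : AddChar K E} (hψ : ψ.IsPrimitive) {v : K → E} (hne : v ≠ 0)
    {ε : ℤ} (hε : ε = 1 ∨ ε = -1)
    (hv : ∀ k, quadraticChar K k = ε → wordTransform ψ v k = 0)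
    {S : Finset K} (hS : ∀ z, v z ≠ 0 → z ∈ S) :
    Fintype.card K ≤ S.card ^ 2 ∧
      (quadraticChar K (-1) = -1 → Fintype.card K ≤ S.card ^ 2 - S.card + 1) := by
  by_cases h0 : ∑ z, v z = 0
  swap
  · exact card_le_of_quadraticChar_of_sum_ne_zero hK hψ hε hv h0 hS
  obtain ⟨z₀, hz₀⟩ := Function.ne_iff.mp hne
  set v' : K → E := fun z => quadraticCharOn K E z * v (z₀ - z⁻¹) with hv'
  have ht0 : wordTransform ψ v 0 = 0 := by simpa [wordTransform] using h0
  have hv'ε : ∀ k, quadraticChar K k = ε → wordTransform ψ v' k = 0 := by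
    intro k hk
    apply (mul_eq_zero_iff_left hcard).mp
    rw [wordTransform_gleasonPrange hψ]
    refine Finset.sum_eq_zero fun j _ => ?_
    by_cases hj0 : j = 0
    · simp [hj0, ht0]
    by_cases hj : quadraticChar K j = ε
    · simp [hv j hj]
    · rw [sum_quadraticCharOn_mul_kloosterman, mul_zero]
      rw [map_mul, hk]
      rcases quadraticChar_dichotomy hj0 with h | h <;> rw [h] at hj ⊢ <;> lia
  have hv'0 : ∑ z, v' z ≠ 0 := by
    have h1 : (Fintype.card K : E) * ∑ z, v' z =
        -ε * gaussSum (quadraticCharOn K E) ψ * (Fintype.card K * v z₀) := by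
      have h2 : ∑ z, v' z = wordTransform ψ v' 0 := by simp [wordTransform]
      rw [h2, wordTransform_gleasonPrange hψ, ← sum_char_mul_wordTransform hψ, Finset.mul_sum]
      refine Finset.sum_congr rfl fun j _ => ?_
      by_cases hj0 : j = 0
      · simp [hj0, ht0]
      by_cases hj : quadraticChar K j = ε
      · simp [hv j hj]
      · simp_rw [zero_mul, zero_add]
        rw [sum_quadraticCharOn_mul_inv hj0, quadraticCharOn_apply]
        have : quadraticChar K j = -ε := by
          rcases quadraticChar_dichotomy hj0 with h | h <;> rw [h] at hj ⊢ <;> lia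
        rw [this]
        push_cast
        ring
    intro h3
    rw [h3, mul_zero] at h1
    have hεE : (ε : E) ≠ 0 := by rcases hε with rfl | rfl <;> simp
    exact mul_ne_zero (mul_ne_zero (neg_ne_zero.mpr hεE)
      (gaussSum_quadraticCharOn_ne_zero hcard hψ)) (mul_ne_zero hcard hz₀) h1.symm
  have hz₀S : z₀ ∈ S := hS _ hz₀
  obtain ⟨hb1, hb2⟩ := card_le_of_quadraticChar_of_sum_ne_zero hK hψ hε hv'ε hv'0
    (S := (S.erase z₀).image fun x => (z₀ - x)⁻¹) (by
      intro z hz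
      have hz0 : z ≠ 0 := by
        rintro rfl
        simp [hv', quadraticCharOn_apply] at hz
      refine Finset.mem_image.mpr ⟨z₀ - z⁻¹, Finset.mem_erase.mpr ⟨by simpa using hz0, ?_⟩, by simp⟩
      exact hS _ (right_ne_zero_of_mul hz))
  set w := ((S.erase z₀).image fun x => (z₀ - x)⁻¹).card
  have hw : w ≤ S.card := Finset.card_image_le.trans (Finset.card_erase_le)
  refine ⟨hb1.trans (Nat.pow_le_pow_left hw 2), fun h => (hb2 h).trans ?_⟩
  rw [sq, sq, ← Nat.mul_sub_one, ← Nat.mul_sub_one]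
  gcongr

/-- A word on `A × B` whose transform vanishes on one class of units for the product of the
quadratic characters. -/
theorem min_card_le_of_quadraticChar_mul {A B : Type*} [Field A] [Fintype A] [DecidableEq A]
    [Field B] [Fintype B] [DecidableEq B] (hB : ringChar B ≠ 2)
    (hcA : (Fintype.card A : E) ≠ 0) (hcB : (Fintype.card B : E) ≠ 0)
    {ψ₁ : AddChar A E} {ψ₂ : AddChar B E} (hψ₁ : ψ₁.IsPrimitive) (hψ₂ : ψ₂.IsPrimitive)
    {c : A × B → E} (hc : c ≠ 0) {ε : ℤ} (hε : ε = 1 ∨ ε = -1)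
    (hv : ∀ x y, quadraticChar A x * quadraticChar B y = ε →
      ∑ t, ∑ s, c (s, t) * (ψ₁ (x * s) * ψ₂ (y * t)) = 0)
    {S : Finset (A × B)} (hS : ∀ z, c z ≠ 0 → z ∈ S) :
    min (Fintype.card A) (Fintype.card B) ≤ S.card ^ 2 ∧
      (quadraticChar B (-1) = -1 →
        min (Fintype.card A) (Fintype.card B) ≤ S.card ^ 2 - S.card + 1) := by
  set row : A → B → E := fun x t => wordTransform ψ₁ (fun s => c (s, t)) x with hrow
  by_cases hall : ∀ x ≠ 0, row x = 0
  · obtain ⟨⟨s₀, t₀⟩, hst⟩ := Function.ne_iff.mp hc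
    have hconst : ∀ s, (Fintype.card A : E) * c (s, t₀) = row 0 t₀ := by
      intro s
      rw [← sum_char_mul_wordTransform hψ₁ (fun s => c (s, t₀)) s, Finset.sum_eq_single 0]
      · simp [hrow]
      · intro x _ hx
        have := congrFun (hall x hx) t₀
        simp only [hrow, Pi.zero_apply] at this
        rw [this, mul_zero]
      · simp
    have hmem : ∀ s, (s, t₀) ∈ S := by
      intro s
      apply hS
      have : (Fintype.card A : E) * c (s, t₀) = Fintype.card A * c (s₀, t₀) := by
        rw [hconst, hconst]
      rw [mul_left_cancel₀ hcA this]
      exact hst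
    have hle : Fintype.card A ≤ S.card := by
      refine Finset.card_le_card_of_injOn (s := Finset.univ) (fun s => (s, t₀))
        (fun s _ => hmem s) ?_
      intro s _ s' _ h
      exact (Prod.mk.inj h).1
    have hmin := (min_le_left (Fintype.card A) (Fintype.card B)).trans hle
    refine ⟨hmin.trans (Nat.le_self_pow two_ne_zero _), fun _ => hmin.trans ?_⟩
    rw [sq, ← Nat.mul_sub_one]
    rcases Nat.eq_zero_or_pos S.card with h | h
    · lia
    · obtain ⟨w, hw⟩ := Nat.exists_eq_add_of_lt h
      rw [hw]
      simp only [zero_add, Nat.add_sub_cancel]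
      nlinarith
  · push Not at hall
    obtain ⟨x, hx, hxne⟩ := hall
    have hχ := quadraticChar_dichotomy hx
    obtain ⟨hb1, hb2⟩ := card_le_of_quadraticChar hB hcB hψ₂ hxne
      (ε := quadraticChar A x * ε) (S := S.image Prod.snd)
      (by rcases hχ with h | h <;> rcases hε with rfl | rfl <;> rw [h] <;> simp)
      (by
        intro y hy
        rw [← hv x y]
        · simp_rw [hrow, wordTransform, Finset.sum_mul, mul_assoc]
        · rw [hy, ← mul_assoc, ← sq, quadraticChar_sq_one hx, one_mul])
      (by
        intro t ht
        obtain ⟨s, _, hs⟩ := Finset.exists_ne_zero_of_sum_ne_zero ht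
        exact Finset.mem_image.mpr ⟨(s, t), hS _ (left_ne_zero_of_mul hs), rfl⟩)
    have hw : (S.image Prod.snd).card ≤ S.card := Finset.card_image_le
    refine ⟨(min_le_right _ _).trans (hb1.trans (Nat.pow_le_pow_left hw 2)),
      fun h => (min_le_right _ _).trans ((hb2 h).trans ?_)⟩
    rw [sq, sq, ← Nat.mul_sub_one, ← Nat.mul_sub_one]
    gcongr

theorem min_card_le_of_quadraticChar_mul_symm {A B E : Type*} [Field A] [Fintype A]
    [DecidableEq A] [Field B] [Fintype B] [DecidableEq B] [Field E]
    (hA : ringChar A ≠ 2) (hB : ringChar B ≠ 2)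
    (hcA : (Fintype.card A : E) ≠ 0) (hcB : (Fintype.card B : E) ≠ 0)
    {ψ₁ : AddChar A E} {ψ₂ : AddChar B E} (hψ₁ : ψ₁.IsPrimitive) (hψ₂ : ψ₂.IsPrimitive)
    {c : A × B → E} (hc : c ≠ 0) {ε : ℤ} (hε : ε = 1 ∨ ε = -1)
    (hv : ∀ x y, quadraticChar A x * quadraticChar B y = ε →
      ∑ t, ∑ s, c (s, t) * (ψ₁ (x * s) * ψ₂ (y * t)) = 0)
    {S : Finset (A × B)} (hS : ∀ z, c z ≠ 0 → z ∈ S) :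
    min (Fintype.card A) (Fintype.card B) ≤ S.card ^ 2 ∧
      (quadraticChar A (-1) * quadraticChar B (-1) = -1 →
        min (Fintype.card A) (Fintype.card B) ≤ S.card ^ 2 - S.card + 1) := by
  obtain ⟨h1, h2⟩ := min_card_le_of_quadraticChar_mul hB hcA hcB hψ₁ hψ₂ hc hε hv hS
  have hc' : (fun z : B × A => c z.swap) ≠ 0 := by
    obtain ⟨z, hz⟩ := Function.ne_iff.mp hc
    exact Function.ne_iff.mpr ⟨z.swap, by simpa using hz⟩
  obtain ⟨-, h3⟩ := min_card_le_of_quadraticChar_mul hA hcB hcA hψ₂ hψ₁ hc' hε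
    (S := S.map (Equiv.prodComm A B).toEmbedding)
    (by
      intro y x hyx
      rw [Finset.sum_comm, ← hv x y (by rw [mul_comm, hyx])]
      simp only [Prod.swap_prod_mk, mul_comm (ψ₂ _)])
    (by
      intro z hz
      exact Finset.mem_map.mpr ⟨z.swap, hS _ hz, by simp⟩)
  rw [Finset.card_map, min_comm] at h3
  refine ⟨h1, fun h => ?_⟩
  rcases quadraticChar_dichotomy (neg_ne_zero.mpr (one_ne_zero (α := A))) with hA1 | hA1
  · exact h2 (by rwa [hA1, one_mul] at h)
  · exact h3 hA1

end QuadraticResidueCodes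

section Generators

variable {K : Type*} [Field K] [Fintype K]

theorem exists_pow_eq_of_orderOf_eq {g : K} (hg : orderOf g = Fintype.card K - 1) {x : K}
    (hx : x ≠ 0) : ∃ k, g ^ k = x := by
  classical
  have hg0 : g ≠ 0 := by
    rintro rfl
    rw [orderOf_zero] at hg
    have := Fintype.one_lt_card (α := K)
    lia
  have ho : orderOf (Units.mk0 g hg0) = Fintype.card Kˣ := by
    rw [← orderOf_units, Units.val_mk0, hg, Fintype.card_units]
  obtain ⟨k, hk⟩ : Units.mk0 x hx ∈ Submonoid.powers (Units.mk0 g hg0) := by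
    rw [mem_powers_iff_mem_zpowers, Subgroup.eq_top_of_card_eq (Subgroup.zpowers (Units.mk0 g hg0))
      (by rw [Nat.card_zpowers, ho, Nat.card_eq_fintype_card])]
    trivial
  exact ⟨k, by simpa using congrArg Units.val hk⟩

theorem quadraticChar_eq_neg_one_of_orderOf_eq [DecidableEq K] (hK : ringChar K ≠ 2) {g : K}
    (hg : orderOf g = Fintype.card K - 1) : quadraticChar K g = -1 := by
  obtain ⟨a, ha⟩ := quadraticChar_exists_neg_one hK
  have ha0 : a ≠ 0 := by
    rintro rfl
    simp at ha
  obtain ⟨k, rfl⟩ := exists_pow_eq_of_orderOf_eq hg ha0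
  rw [map_pow] at ha
  have hg0 : g ≠ 0 := by
    rintro rfl
    rw [orderOf_zero] at hg
    have := Fintype.one_lt_card (α := K)
    lia
  rcases quadraticChar_dichotomy hg0 with h | h
  · rw [h, one_pow] at ha
    norm_num at ha
  · exact h

end Generators

section ProductCharacter

variable {n₁ n₂ : ℕ} [Fact n₁.Prime] [Fact n₂.Prime]

/-- The product of the quadratic characters modulo two coprime primes. -/
def zmodQuadraticChar (h : n₁.Coprime n₂) (x : ZMod (n₁ * n₂)) : ℤ :=
  quadraticChar (ZMod n₁) (ZMod.chineseRemainder h x).1 *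
    quadraticChar (ZMod n₂) (ZMod.chineseRemainder h x).2

theorem zmodQuadraticChar_mul (h : n₁.Coprime n₂) (x y : ZMod (n₁ * n₂)) :
    zmodQuadraticChar h (x * y) = zmodQuadraticChar h x * zmodQuadraticChar h y := by
  simp only [zmodQuadraticChar, map_mul, Prod.fst_mul, Prod.snd_mul]
  ring

theorem zmodQuadraticChar_pow (h : n₁.Coprime n₂) (x : ZMod (n₁ * n₂)) (k : ℕ) :
    zmodQuadraticChar h (x ^ k) = zmodQuadraticChar h x ^ k := by
  simp only [zmodQuadraticChar, map_pow, Prod.pow_fst, Prod.pow_snd, mul_pow]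

theorem zmodQuadraticChar_natCast (h : n₁.Coprime n₂) (a : ℕ) :
    zmodQuadraticChar h a = quadraticChar (ZMod n₁) a * quadraticChar (ZMod n₂) a := by
  simp [zmodQuadraticChar]

theorem zmodQuadraticChar_ne_zero_iff (h : n₁.Coprime n₂) (x : ZMod (n₁ * n₂)) :
    zmodQuadraticChar h x ≠ 0 ↔
      (ZMod.chineseRemainder h x).1 ≠ 0 ∧ (ZMod.chineseRemainder h x).2 ≠ 0 := by
  simp only [zmodQuadraticChar, ne_eq, mul_eq_zero, quadraticChar_eq_zero_iff, not_or]

theorem zmodQuadraticChar_eq_or (h : n₁.Coprime n₂) {x : ZMod (n₁ * n₂)}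
    (hx : zmodQuadraticChar h x ≠ 0) :
    zmodQuadraticChar h x = 1 ∨ zmodQuadraticChar h x = -1 := by
  obtain ⟨h1, h2⟩ := (zmodQuadraticChar_ne_zero_iff h x).mp hx
  rw [zmodQuadraticChar]
  rcases quadraticChar_dichotomy h1 with h1 | h1 <;>
    rcases quadraticChar_dichotomy h2 with h2 | h2 <;> rw [h1, h2] <;> simp

theorem card_zmodQuadraticChar_ne_zero (h : n₁.Coprime n₂) [NeZero (n₁ * n₂)] :
    (Finset.univ.filter fun x => zmodQuadraticChar h x ≠ 0).card = (n₁ - 1) * (n₂ - 1) := by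
  have : (Finset.univ.filter fun x => zmodQuadraticChar h x ≠ 0) =
      (((Finset.univ : Finset (ZMod n₁)).erase 0) ×ˢ
        ((Finset.univ : Finset (ZMod n₂)).erase 0)).map
        (ZMod.chineseRemainder h).symm.toEquiv.toEmbedding := by
    ext x
    simp [Finset.mem_map_equiv, zmodQuadraticChar_ne_zero_iff]
  rw [this, Finset.card_map, Finset.card_product]
  simp

theorem card_zmodQuadraticChar_eq (h : n₁.Coprime n₂) [NeZero (n₁ * n₂)] {u : ZMod (n₁ * n₂)}
    (hu : zmodQuadraticChar h u = -1) {ε : ℤ} (hε : ε = 1 ∨ ε = -1) :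
    2 * (Finset.univ.filter fun x => zmodQuadraticChar h x = ε).card = (n₁ - 1) * (n₂ - 1) := by
  have hunit : IsUnit u := by
    obtain ⟨h1, h2⟩ := (zmodQuadraticChar_ne_zero_iff h u).mp (by rw [hu]; norm_num)
    rw [← isUnit_map_iff (ZMod.chineseRemainder h), Prod.isUnit_iff]
    exact ⟨h1.isUnit, h2.isUnit⟩
  have hle : ∀ δ : ℤ, (Finset.univ.filter fun x => zmodQuadraticChar h x = δ).card ≤
      (Finset.univ.filter fun x => zmodQuadraticChar h x = -δ).card := by
    intro δ
    refine Finset.card_le_card_of_injOn (fun x => u * x) ?_ ?_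
    · intro x hx
      simp only [Finset.coe_filter, Finset.mem_univ, true_and, Set.mem_ofPred_eq] at hx ⊢
      rw [zmodQuadraticChar_mul, hu, hx, neg_one_mul]
    · intro x _ y _ hxy
      exact hunit.mul_left_cancel hxy
  have heq := (hle ε).antisymm (by simpa using hle (-ε))
  rw [← card_zmodQuadraticChar_ne_zero h, two_mul]
  nth_rewrite 2 [heq]
  rw [← Finset.card_union_of_disjoint]
  · congr 1
    ext x
    simp only [Finset.mem_union, Finset.mem_filter, Finset.mem_univ, true_and]
    constructor
    · rcases hε with rfl | rfl <;> rintro (hx | hx) <;> rw [hx] <;> norm_num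
    · intro hx
      rcases hε with rfl | rfl <;> rcases zmodQuadraticChar_eq_or h hx with h | h <;> simp [h]
  · rw [Finset.disjoint_filter]
    rintro x - hx hx'
    rcases hε with rfl | rfl <;> rw [hx] at hx' <;> norm_num at hx'

/-- Every unit modulo `n₁ * n₂` lies in one of the Whiteman classes. -/
theorem exists_eq_pow_mul_pow (h : n₁.Coprime n₂) {g u : ℕ}
    (hg₁ : orderOf (g : ZMod n₁) = n₁ - 1) (hg₂ : orderOf (g : ZMod n₂) = n₂ - 1)
    (hu₁ : (u : ZMod n₁) = (g : ZMod n₁)) (hu₂ : (u : ZMod n₂) = 1)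
    {d e : ℕ} (hd : Nat.gcd (n₁ - 1) (n₂ - 1) = d)
    (he : e = (n₁ - 1) * (n₂ - 1) / d) {x : ZMod (n₁ * n₂)} (hx : zmodQuadraticChar h x ≠ 0) :
    ∃ i < d, ∃ s < e, x = (g : ZMod (n₁ * n₂)) ^ s * (u : ZMod (n₁ * n₂)) ^ i := by
  have hp₁ := (Fact.out : n₁.Prime).one_lt
  have hp₂ := (Fact.out : n₂.Prime).one_lt
  have hd0 : 0 < d := hd ▸ Nat.gcd_pos_of_pos_left _ (by lia)
  obtain ⟨hx1, hx2⟩ := (zmodQuadraticChar_ne_zero_iff h x).mp hx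
  obtain ⟨a, ha⟩ := exists_pow_eq_of_orderOf_eq (by rw [hg₁, ZMod.card]) hx1
  obtain ⟨b, hb⟩ := exists_pow_eq_of_orderOf_eq (by rw [hg₂, ZMod.card]) hx2
  have hg0 : (g : ZMod n₁) ≠ 0 := by
    intro h0
    rw [h0, orderOf_zero] at hg₁
    lia
  obtain ⟨i, hi, hmod⟩ : ∃ i < d, b + i ≡ a [MOD d] := by
    refine ⟨(a + (d - 1) * b) % d, Nat.mod_lt _ hd0, ?_⟩
    refine (Nat.ModEq.add_left b (Nat.mod_modEq _ _)).trans ?_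
    have : b + (a + (d - 1) * b) = a + d * b := by
      obtain ⟨d, rfl⟩ := Nat.exists_eq_add_of_lt hd0
      simp only [zero_add, Nat.add_sub_cancel]
      ring
    rw [this]
    simp [Nat.ModEq]
  obtain ⟨N, hN⟩ : ∃ N, d * N ≥ i ∧ n₁ - 1 ∣ d * N := ⟨(n₁ - 1) * i, by
    have : 1 ≤ n₁ - 1 := by lia
    constructor
    · nlinarith [Nat.mul_le_mul hd0 this, Nat.mul_le_mul (Nat.mul_le_mul hd0 this) (le_refl i)]
    · exact ⟨d * i, by ring⟩⟩
  have hcompat : a + (d * N - i) ≡ b [MOD Nat.gcd (n₁ - 1) (n₂ - 1)] := by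
    rw [hd]
    apply Nat.ModEq.add_right_cancel' i
    rw [add_assoc, Nat.sub_add_cancel hN.1]
    refine Nat.ModEq.trans ?_ hmod.symm
    simp [Nat.ModEq]
  have hs := (Nat.chineseRemainder' hcompat).2
  have hlt := Nat.chineseRemainder'_lt_lcm hcompat (by lia) (by lia)
  set s := (Nat.chineseRemainder' hcompat : ℕ)
  refine ⟨i, hi, s, by rwa [he, ← hd], ?_⟩
  apply (ZMod.chineseRemainder h).injective
  apply Prod.ext
  · rw [← ha]
    simp only [map_mul, map_pow, map_natCast, Prod.fst_mul, Prod.pow_fst, Prod.fst_natCast, hu₁]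
    rw [← pow_add]
    have hu : IsUnit (g : ZMod n₁) := hg0.isUnit
    have hmod' : a ≡ s + i [MOD n₁ - 1] := by
      refine Nat.ModEq.symm ((hs.1.add_right i).trans ?_)
      rw [add_assoc, Nat.sub_add_cancel hN.1]
      exact ((Nat.modEq_zero_iff_dvd.mpr hN.2).add_left a)
    rw [← hg₁] at hmod'
    rw [← pow_mod_orderOf, hmod', pow_mod_orderOf]
  · rw [← hb]
    simp only [map_mul, map_pow, map_natCast, Prod.snd_mul, Prod.pow_snd, Prod.snd_natCast, hu₂,
      one_pow, mul_one]
    have := hs.2.symm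
    rw [← hg₂] at this
    rw [← pow_mod_orderOf, this, pow_mod_orderOf]

/-- The two unions of alternate Whiteman classes are the level sets of the product of the
quadratic characters. -/
theorem whiteman_mem_iff (h : n₁.Coprime n₂) (h₁ : n₁ ≠ 2) (h₂ : n₂ ≠ 2) {g u e : ℕ}
    (hg₁ : orderOf (g : ZMod n₁) = n₁ - 1) (hg₂ : orderOf (g : ZMod n₂) = n₂ - 1)
    (hu₁ : (u : ZMod n₁) = (g : ZMod n₁)) (hu₂ : (u : ZMod n₂) = 1)
    (h6 : Nat.gcd (n₁ - 1) (n₂ - 1) = 6) (he : e = (n₁ - 1) * (n₂ - 1) / 6)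
    {W : ℕ → Finset (ZMod (n₁ * n₂))}
    (hW : ∀ i, (W i : Set (ZMod (n₁ * n₂))) =
      {x | ∃ s < e, x = (g : ZMod (n₁ * n₂)) ^ s * (u : ZMod (n₁ * n₂)) ^ i})
    (x : ZMod (n₁ * n₂)) :
    (x ∈ W 0 ∪ W 2 ∪ W 4 ↔ zmodQuadraticChar h x = 1) ∧
      (x ∈ W 1 ∪ W 3 ∪ W 5 ↔ zmodQuadraticChar h x = -1) ∧
      zmodQuadraticChar h (u : ZMod (n₁ * n₂)) = -1 := by
  have hχ₁ := quadraticChar_eq_neg_one_of_orderOf_eq (by rwa [ZMod.ringChar_zmod_n])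
    (hg₁.trans (by rw [ZMod.card]))
  have hχ₂ := quadraticChar_eq_neg_one_of_orderOf_eq (by rwa [ZMod.ringChar_zmod_n])
    (hg₂.trans (by rw [ZMod.card]))
  have hgJ : zmodQuadraticChar h (g : ZMod (n₁ * n₂)) = 1 := by
    rw [zmodQuadraticChar_natCast, hχ₁, hχ₂]; norm_num
  have huJ : zmodQuadraticChar h (u : ZMod (n₁ * n₂)) = -1 := by
    rw [zmodQuadraticChar_natCast, hu₁, hu₂, hχ₁, map_one]; norm_num
  have hmem : ∀ i, x ∈ W i ↔ ∃ s < e, x = (g : ZMod (n₁ * n₂)) ^ s * (u : ZMod (n₁ * n₂)) ^ i := by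
    intro i
    rw [← Finset.mem_coe, hW]
    rfl
  have hJ : ∀ i, x ∈ W i → zmodQuadraticChar h x = (-1) ^ i := by
    intro i hx
    obtain ⟨s, -, rfl⟩ := (hmem i).mp hx
    rw [zmodQuadraticChar_mul, zmodQuadraticChar_pow, zmodQuadraticChar_pow, hgJ, huJ, one_pow,
      one_mul]
  have hcover : zmodQuadraticChar h x ≠ 0 → ∃ i < 6, x ∈ W i := by
    intro hx
    obtain ⟨i, hi, hs⟩ := exists_eq_pow_mul_pow h hg₁ hg₂ hu₁ hu₂ h6 he hx
    exact ⟨i, hi, (hmem i).mpr hs⟩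
  simp only [Finset.mem_union]
  refine ⟨⟨?_, ?_⟩, ⟨?_, ?_⟩, huJ⟩
  · rintro ((hx | hx) | hx) <;> rw [hJ _ hx] <;> norm_num
  · intro hx
    obtain ⟨i, hi, hxi⟩ := hcover (by rw [hx]; norm_num)
    have := hJ i hxi
    rw [hx] at this
    interval_cases i <;> tauto
  · rintro ((hx | hx) | hx) <;> rw [hJ _ hx] <;> norm_num
  · intro hx
    obtain ⟨i, hi, hxi⟩ := hcover (by rw [hx]; norm_num)
    have := hJ i hxi
    rw [hx] at this
    interval_cases i <;> tauto

end ProductCharacter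

section CyclicCodes

/-- The weight bound for a polynomial whose values at the `n₁ * n₂`-th roots of unity vanish on
one class of the product of the quadratic characters. -/
theorem min_le_card_support_of_eval {n₁ n₂ : ℕ} [Fact n₁.Prime] [Fact n₂.Prime]
    (h : n₁.Coprime n₂) (h₁ : n₁ ≠ 2) (h₂ : n₂ ≠ 2) {E : Type*} [Field E] {β : E}
    (hβ : IsPrimitiveRoot β (n₁ * n₂)) {f : E[X]} (hf : f ≠ 0) (hdeg : f.natDegree < n₁ * n₂)
    {ε : ℤ} (hε : ε = 1 ∨ ε = -1)
    (hv : ∀ k, zmodQuadraticChar h k = ε → f.eval (β ^ k.val) = 0) :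
    min n₁ n₂ ≤ f.support.card ^ 2 ∧
      (zmodQuadraticChar h (-1) = -1 →
        min n₁ n₂ ≤ f.support.card ^ 2 - f.support.card + 1) := by
  have hne : NeZero (n₁ * n₂) := ⟨mul_ne_zero (NeZero.ne n₁) (NeZero.ne n₂)⟩
  have hnE : ((n₁ * n₂ : ℕ) : E) ≠ 0 := hβ.neZero'.out
  rw [Nat.cast_mul] at hnE
  set r := ZMod.chineseRemainder h
  let Ψ : AddChar (ZMod (n₁ * n₂)) E := AddChar.zmodChar _ hβ.pow_eq_one
  have hΨ : ∀ k, Ψ k = β ^ k.val := AddChar.zmodChar_apply _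
  have hΨ1 : ∀ k, Ψ k = 1 → k = 0 := by
    intro k hk
    rw [hΨ, hβ.pow_eq_one_iff_dvd] at hk
    rw [← ZMod.val_eq_zero]
    exact Nat.eq_zero_of_dvd_of_lt hk (ZMod.val_lt k)
  let ψ₁ : AddChar (ZMod n₁) E :=
    Ψ.compAddMonoidHom (r.symm.toAddEquiv.toAddMonoidHom.comp (AddMonoidHom.inl _ _))
  let ψ₂ : AddChar (ZMod n₂) E :=
    Ψ.compAddMonoidHom (r.symm.toAddEquiv.toAddMonoidHom.comp (AddMonoidHom.inr _ _))
  have hψ₁a : ∀ s, ψ₁ s = Ψ (r.symm (s, 0)) := fun _ => rfl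
  have hψ₂a : ∀ t, ψ₂ t = Ψ (r.symm (0, t)) := fun _ => rfl
  have hψ₁ : ψ₁.IsPrimitive := by
    apply AddChar.IsPrimitive.of_ne_one
    intro h1
    have := hΨ1 (r.symm (1, 0)) (by rw [← hψ₁a, h1, AddChar.one_apply])
    rw [EmbeddingLike.map_eq_zero_iff] at this
    exact one_ne_zero (Prod.mk.inj this).1
  have hψ₂ : ψ₂.IsPrimitive := by
    apply AddChar.IsPrimitive.of_ne_one
    intro h1
    have := hΨ1 (r.symm (0, 1)) (by rw [← hψ₂a, h1, AddChar.one_apply])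
    rw [EmbeddingLike.map_eq_zero_iff] at this
    exact one_ne_zero (Prod.mk.inj this).2
  let c : ZMod n₁ × ZMod n₂ → E := fun z => f.coeff (r.symm z).val
  have hc : c ≠ 0 := by
    obtain ⟨i, hi⟩ := Polynomial.support_nonempty.mpr hf
    have hlt : i < n₁ * n₂ := (Polynomial.le_natDegree_of_mem_supp i hi).trans_lt hdeg
    refine Function.ne_iff.mpr ⟨r (i : ZMod (n₁ * n₂)), ?_⟩
    simp only [c, RingEquiv.symm_apply_apply, ZMod.val_natCast_of_lt hlt]
    exact Polynomial.mem_support_iff.mp hi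
  have heval : ∀ k, f.eval (β ^ k.val) = ∑ z, f.coeff z.val * Ψ (k * z) := by
    intro k
    rw [Polynomial.eval_eq_sum_range' hdeg]
    refine Finset.sum_nbij' (fun i => (i : ZMod (n₁ * n₂))) ZMod.val (by simp)
      (fun z _ => Finset.mem_range.mpr (ZMod.val_lt z)) ?_ (by simp) ?_
    · intro i hi
      exact ZMod.val_natCast_of_lt (Finset.mem_range.mp hi)
    · intro i hi
      rw [hΨ, ZMod.val_mul, ZMod.val_natCast_of_lt (Finset.mem_range.mp hi),
        ← pow_eq_pow_mod _ hβ.pow_eq_one, pow_mul]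
  have hvan : ∀ x y, quadraticChar (ZMod n₁) x * quadraticChar (ZMod n₂) y = ε →
      ∑ t, ∑ s, c (s, t) * (ψ₁ (x * s) * ψ₂ (y * t)) = 0 := by
    intro x y hxy
    rw [← hv (r.symm (x, y)) (by rw [zmodQuadraticChar]; simpa [r] using hxy), heval,
      ← Fintype.sum_prod_type_right', ← r.symm.toEquiv.sum_comp]
    refine Finset.sum_congr rfl fun z _ => ?_
    have : r.symm (x, y) * r.symm z = r.symm (x * z.1, 0) + r.symm (0, y * z.2) := by
      rw [← map_mul, ← map_add]
      congr 1
      ext <;> simp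
    change _ = f.coeff (r.symm z).val * Ψ (r.symm (x, y) * r.symm z)
    rw [this, AddChar.map_add_eq_mul]
    rfl
  classical
  have hS : (Finset.univ.filter fun z => c z ≠ 0).card ≤ f.support.card := by
    refine Finset.card_le_card_of_injOn (fun z => (r.symm z).val) ?_ ?_
    · intro z hz
      simpa [c] using hz
    · intro z _ z' _ hz
      exact r.symm.injective (ZMod.val_injective _ hz)
  obtain ⟨hb1, hb2⟩ := min_card_le_of_quadraticChar_mul_symm
    (by rwa [ZMod.ringChar_zmod_n]) (by rwa [ZMod.ringChar_zmod_n])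
    (by rw [ZMod.card]; exact left_ne_zero_of_mul hnE)
    (by rw [ZMod.card]; exact right_ne_zero_of_mul hnE) hψ₁ hψ₂ hc hε hvan
    (S := Finset.univ.filter fun z => c z ≠ 0) (by simp)
  rw [ZMod.card, ZMod.card] at hb1 hb2
  refine ⟨hb1.trans (Nat.pow_le_pow_left hS 2), fun hneg => (hb2 ?_).trans ?_⟩
  · simpa [zmodQuadraticChar] using hneg
  · rw [sq, sq, ← Nat.mul_sub_one, ← Nat.mul_sub_one]
    gcongr

theorem natDegree_of_generator_identity {E : Type*} [Field E] {n₁ n₂ n : ℕ} (h₁ : n₁ ≠ 0)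
    (h₂ : n₂ ≠ 0) (hn : n ≠ 0) {g d : E[X]} (hd : d.Monic)
    (hg : g * ((X ^ n₁ - 1) * (X ^ n₂ - 1) * d) = (X ^ n - 1) * (X - 1)) :
    g.natDegree + (n₁ + n₂ + d.natDegree) = n + 1 := by
  have hm : ∀ k ≠ 0, (X ^ k - 1 : E[X]).Monic := fun k hk => monic_X_pow_sub_C 1 hk
  have hX : (X - 1 : E[X]).Monic := monic_X_sub_C 1
  have hdX : (X - 1 : E[X]).natDegree = 1 := natDegree_X_sub_C 1
  have hdeg : ∀ k, (X ^ k - 1 : E[X]).natDegree = k := fun k => natDegree_X_pow_sub_C (r := 1)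
  have h12 := (hm _ h₁).mul (hm _ h₂)
  have hg0 : g ≠ 0 := by
    rintro rfl
    rw [zero_mul] at hg
    exact ((hm _ hn).mul hX).ne_zero hg.symm
  have := congrArg natDegree hg
  rw [natDegree_mul hg0 (h12.mul hd).ne_zero, h12.natDegree_mul hd,
    (hm _ h₁).natDegree_mul (hm _ h₂), (hm _ hn).natDegree_mul hX, hdeg, hdeg, hdeg, hdX] at this
  exact this

theorem eval_eq_zero_of_generator_identity {n₁ n₂ : ℕ} [Fact n₁.Prime] [Fact n₂.Prime]
    (h : n₁.Coprime n₂) {E : Type*} [Field E] {β : E}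
    (hβ : IsPrimitiveRoot β (n₁ * n₂)) {D : Finset (ZMod (n₁ * n₂))} {g : E[X]}
    (hg : g * ((X ^ n₁ - 1) * (X ^ n₂ - 1) * ∏ i ∈ D, (X - C (β ^ i.val))) =
      (X ^ (n₁ * n₂) - 1) * (X - 1))
    {k : ZMod (n₁ * n₂)} (hk : zmodQuadraticChar h k ≠ 0) (hkD : k ∉ D) :
    g.eval (β ^ k.val) = 0 := by
  have hne : NeZero (n₁ * n₂) := ⟨mul_ne_zero (NeZero.ne n₁) (NeZero.ne n₂)⟩
  obtain ⟨hk1, hk2⟩ := (zmodQuadraticChar_ne_zero_iff h k).mp hk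
  have hcast : ZMod.chineseRemainder h k =
      (((k.val : ℕ) : ZMod n₁), ((k.val : ℕ) : ZMod n₂)) := by
    conv_lhs => rw [← ZMod.natCast_zmod_val k]
    rw [map_natCast]
    rfl
  rw [hcast] at hk1 hk2
  have he := congrArg (eval (β ^ k.val)) hg
  have hpow : (β ^ k.val) ^ (n₁ * n₂) = 1 := by
    rw [← pow_mul, mul_comm, pow_mul, hβ.pow_eq_one, one_pow]
  simp only [eval_mul, eval_sub, eval_pow, eval_X, eval_one, hpow, sub_self, zero_mul,
    eval_prod, eval_C] at he
  refine (mul_eq_zero.mp he).resolve_right ?_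
  refine mul_ne_zero (mul_ne_zero ?_ ?_) ?_
  · intro h0
    rw [sub_eq_zero, ← pow_mul, hβ.pow_eq_one_iff_dvd, mul_comm k.val] at h0
    apply hk2
    rw [ZMod.natCast_eq_zero_iff]
    exact Nat.dvd_of_mul_dvd_mul_left (Nat.pos_of_neZero n₁) h0
  · intro h0
    rw [sub_eq_zero, ← pow_mul, hβ.pow_eq_one_iff_dvd] at h0
    apply hk1
    rw [ZMod.natCast_eq_zero_iff]
    exact Nat.dvd_of_mul_dvd_mul_right (Nat.pos_of_neZero n₂) h0
  · rw [Finset.prod_ne_zero_iff]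
    intro i hi h0
    rw [sub_eq_zero] at h0
    have := ZMod.val_injective _ (hβ.pow_inj (ZMod.val_lt k) (ZMod.val_lt i) h0)
    exact hkD (this ▸ hi)

end CyclicCodes

theorem stmt_19
    (n₁ n₂ n e g u : ℕ)
    (hp₁ : n₁.Prime) (hp₂ : n₂.Prime)
    (hodd₁ : Odd n₁) (hodd₂ : Odd n₂) (hne : n₁ ≠ n₂)
    (h6 : Nat.gcd (n₁ - 1) (n₂ - 1) = 6)
    (hn : n = n₁ * n₂)
    (he : e = (n₁ - 1) * (n₂ - 1) / 6)
    (hg₁ : orderOf (g : ZMod n₁) = n₁ - 1)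
    (hg₂ : orderOf (g : ZMod n₂) = n₂ - 1)
    (hu₁ : (u : ZMod n₁) = (g : ZMod n₁))
    (hu₂ : (u : ZMod n₂) = 1)
    (W : ℕ → Finset (ZMod n))
    (hW : ∀ i, (W i : Set (ZMod n)) =
      {x | ∃ s < e, x = (g : ZMod n) ^ s * (u : ZMod n) ^ i})
    (D₀ D₁ : Finset (ZMod n))
    (hD₀ : D₀ = W 0 ∪ W 2 ∪ W 4) (hD₁ : D₁ = W 1 ∪ W 3 ∪ W 5)
    (p a q m : ℕ) (hp : p.Prime) (ha : 0 < a) (hq : q = p ^ a)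
    (hco : Nat.Coprime n q) (hm : m = orderOf (q : ZMod n))
    (F E : Type) [Field F] [Fintype F] [CharP F p]
    [Field E] [Fintype E] [CharP E p]
    (hF : Fintype.card F = q) (hE : Fintype.card E = q ^ m)
    (φ : F →+* E)
    (β : E) (hβ : IsPrimitiveRoot β n)
    (hqD₀ : ((q : ℕ) : ZMod n) ∈ D₀)
    (dj : Polynomial E)
    (hdj : dj = ∏ i ∈ D₀, (X - C (β ^ i.val)) ∨
           dj = ∏ i ∈ D₁, (X - C (β ^ i.val)))
    (G : Polynomial F)
    (hG : G.map φ * ((X ^ n₁ - 1) * (X ^ n₂ - 1) * dj) = (X ^ n - 1) * (X - 1)) :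
    n - G.natDegree = n₁ + n₂ - 1 + (n₁ - 1) * (n₂ - 1) / 2 ∧
    ∀ dmin : ℕ,
      IsLeast {w : ℕ | ∃ c : Polynomial F,
        c ≠ 0 ∧ c.natDegree < n ∧ G ∣ c ∧ w = c.support.card} dmin →
      min n₁ n₂ ≤ dmin ^ 2 ∧
      ((-1 : ZMod n) ∈ D₁ → min n₁ n₂ ≤ dmin ^ 2 - dmin + 1) := by
  subst hn
  have : Fact n₁.Prime := ⟨hp₁⟩
  have : Fact n₂.Prime := ⟨hp₂⟩
  have h : n₁.Coprime n₂ := (Nat.coprime_primes hp₁ hp₂).mpr hne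
  have h₁ : n₁ ≠ 2 := by rintro rfl; exact absurd hodd₁ (by decide)
  have h₂ : n₂ ≠ 2 := by rintro rfl; exact absurd hodd₂ (by decide)
  have hne0 : NeZero (n₁ * n₂) := ⟨mul_ne_zero (NeZero.ne n₁) (NeZero.ne n₂)⟩
  have hmem := whiteman_mem_iff h h₁ h₂ hg₁ hg₂ hu₁ hu₂ h6 he hW
  rw [← hD₀, ← hD₁] at hmem
  obtain ⟨ε, hε, D, hD, rfl⟩ : ∃ ε : ℤ, (ε = 1 ∨ ε = -1) ∧ ∃ D : Finset (ZMod (n₁ * n₂)),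
      D = Finset.univ.filter (fun x => zmodQuadraticChar h x = ε) ∧
      dj = ∏ i ∈ D, (X - C (β ^ i.val)) := by
    rcases hdj with hdj | hdj
    · exact ⟨1, Or.inl rfl, D₀, by ext x; simp [(hmem x).1], hdj⟩
    · exact ⟨-1, Or.inr rfl, D₁, by ext x; simp [(hmem x).2.1], hdj⟩
  have hcard := card_zmodQuadraticChar_eq h (hmem 0).2.2 hε
  rw [← hD] at hcard
  constructor
  · have hdeg := natDegree_of_generator_identity hp₁.ne_zero hp₂.ne_zero hne0.out
      (monic_prod_of_monic _ _ fun i _ => monic_X_sub_C _) hG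
    rw [natDegree_map, natDegree_prod_of_monic _ _ fun i _ => monic_X_sub_C _] at hdeg
    simp only [natDegree_X_sub_C, Finset.sum_const, smul_eq_mul, mul_one] at hdeg
    lia
  · rintro dmin ⟨⟨c, hc, hcdeg, ⟨b, hb⟩, rfl⟩, -⟩
    obtain ⟨hb1, hb2⟩ := min_le_card_support_of_eval h h₁ h₂ hβ (f := c.map φ) (ε := -ε)
      ((Polynomial.map_ne_zero_iff φ.injective).mpr hc) (by rwa [natDegree_map])
      (by rcases hε with rfl | rfl <;> simp)
      (by
        intro k hk
        rw [hb, Polynomial.map_mul, eval_mul, eval_eq_zero_of_generator_identity h hβ hG, zero_mul]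
        · rw [hk]
          rcases hε with rfl | rfl <;> norm_num
        · rw [hD, Finset.mem_filter, hk]
          rcases hε with rfl | rfl <;> norm_num)
    rw [support_map_of_injective c φ.injective] at hb1 hb2
    exact ⟨hb1, fun hneg => hb2 ((hmem (-1)).2.1.mp hneg)⟩
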